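/- Let a ∈ ℙ^n and let f = {f_b}_{b ≤ a} be an array of integers. Then f is the fine f-vector of a colored complex of type a if and only if f is the fine f-vector of a color-shifted colored complex of type a. -/

import Mathlib

open Finset

/-- The vertex set of a finite simplicial complex, given as its finite set of faces. -/
def vertexSet {α : Type*} [DecidableEq α] (Δ : Finset (Finset α)) : Finset α := Δ.sup id

/-- `Δ` is a (finite) simplicial complex: a nonempty collection of finite subsets
closed under taking subsets.  (Every member of some face then automatically spans
a face, so the vertex condition is automatic.) -/
def IsSimplicialComplex {α : Type*} (Δ : Finset (Finset α)) : Prop :=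
  Δ.Nonempty ∧ ∀ F ∈ Δ, ∀ G ⊆ F, G ∈ Δ

/-- The deletion `dl_Δ(x)` of the vertex `x` from `Δ`. -/
def del {α : Type*} [DecidableEq α] (Δ : Finset (Finset α)) (x : α) : Finset (Finset α) :=
  Δ.filter fun τ => x ∉ τ

/-- The link `lk_Δ(x)` of the vertex `x` in `Δ`. -/
def lk {α : Type*} [DecidableEq α] (Δ : Finset (Finset α)) (x : α) : Finset (Finset α) :=
  Δ.filter fun τ => x ∉ τ ∧ insert x τ ∈ Δ

/-- `F` is a facet (maximal face) of `Δ`. -/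
def IsFacet {α : Type*} (Δ : Finset (Finset α)) (F : Finset α) : Prop :=
  F ∈ Δ ∧ ∀ G ∈ Δ, F ⊆ G → G = F

/-- The simplicial complex `⟨ℱ⟩` generated by a collection `ℱ` of faces. -/
def generatedComplex {α : Type*} [DecidableEq α] (S : Finset (Finset α)) :
    Finset (Finset α) :=
  insert ∅ (S.biUnion Finset.powerset)

/-- `(V 0, …, V (n-1))` is an ordered partition of `W` into nonempty parts. -/
def IsOrderedPartition {α : Type*} [DecidableEq α] {n : ℕ} (V : Fin n → Finset α)
    (W : Finset α) : Prop :=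
  (∀ i, (V i).Nonempty) ∧ (∀ i j, i ≠ j → Disjoint (V i) (V j)) ∧
    Finset.univ.biUnion V = W

/-- `Γ` is an `a`-rib of `Δ`: there is an ordered partition `V` of the vertex set
of `Δ` such that `Γ` is generated by the faces `F` of `Δ` with `|F ∩ V i| = a i`
for every `i`. -/
def IsRib {α : Type*} [DecidableEq α] {n : ℕ} (a : Fin n → ℕ) (Δ Γ : Finset (Finset α)) :
    Prop :=
  ∃ V : Fin n → Finset α, IsOrderedPartition V (vertexSet Δ) ∧
    (Δ.filter fun F => ∀ i, (F ∩ V i).card = a i).Nonempty ∧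
    Γ = generatedComplex (Δ.filter fun F => ∀ i, (F ∩ V i).card = a i)

/-- `Γ` is an `a`-rib of a simplex. -/
def IsRibOfSimplex {α : Type*} [DecidableEq α] {n : ℕ} (a : Fin n → ℕ)
    (Γ : Finset (Finset α)) : Prop :=
  ∃ F : Finset α, F.Nonempty ∧ IsRib a F.powerset Γ

/-- Vertex decomposability, in the non-pure sense of Björner and Wachs. -/
inductive VertexDecomposable {α : Type*} [DecidableEq α] : Finset (Finset α) → Prop
  | simplex (F : Finset α) (hF : F.Nonempty) : VertexDecomposable F.powerset
  | ofEmpty : VertexDecomposable {∅}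
  | shed (Δ : Finset (Finset α)) (x : α) (hC : IsSimplicialComplex Δ) (hx : {x} ∈ Δ)
      (hdl : VertexDecomposable (del Δ x)) (hlk : VertexDecomposable (lk Δ x))
      (hfac : ∀ F, IsFacet (lk Δ x) F → ¬ IsFacet (del Δ x) F) :
      VertexDecomposable Δ

/-- `a`-Macaulay decomposability. -/
inductive MacaulayDecomposable {α : Type*} [DecidableEq α] {n : ℕ} :
    (Fin n → ℕ) → Finset (Finset α) → Prop
  | rib (a : Fin n → ℕ) (Γ : Finset (Finset α)) (h : IsRibOfSimplex a Γ) :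
      MacaulayDecomposable a Γ
  | shed (a a' : Fin n → ℕ) (Δ : Finset (Finset α)) (x : α)
      (hC : IsSimplicialComplex Δ) (hx : {x} ∈ Δ) (hlt : a' < a)
      (hdl : MacaulayDecomposable a (del Δ x))
      (hlk : MacaulayDecomposable a' (lk Δ x))
      (hfac : ∀ F, IsFacet (lk Δ x) F → ¬ IsFacet (del Δ x) F) :
      MacaulayDecomposable a Δ

/-- `(Δ, V)` is a colored complex of type `a`. -/
def IsColoredComplex {α : Type*} [DecidableEq α] {n : ℕ} (a : Fin n → ℕ)
    (Δ : Finset (Finset α)) (V : Fin n → Finset α) : Prop :=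
  IsSimplicialComplex Δ ∧ IsOrderedPartition V (vertexSet Δ) ∧
    ∀ F ∈ Δ, ∀ i, (F ∩ V i).card ≤ a i

/-- `(Δ, V)` is a balanced complex of type `a`: an `a`-colored complex of
dimension `|a| - 1`. -/
def IsBalancedComplex {α : Type*} [DecidableEq α] {n : ℕ} (a : Fin n → ℕ)
    (Δ : Finset (Finset α)) (V : Fin n → Finset α) : Prop :=
  IsColoredComplex a Δ V ∧ (∀ F ∈ Δ, F.card ≤ ∑ i, a i) ∧ ∃ F ∈ Δ, F.card = ∑ i, a i

/-- `(Δ, V)` is color-shifted (with respect to the linear order on the vertices). -/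
def IsColorShifted {α : Type*} [LinearOrder α] {n : ℕ} (Δ : Finset (Finset α))
    (V : Fin n → Finset α) : Prop :=
  ∀ F ∈ Δ, ∀ i : Fin n, ∀ v ∈ V i, ∀ v' ∈ V i,
    v' < v → v ∈ F → v' ∉ F → insert v' (F.erase v) ∈ Δ

/-- `Δ` is pure: all facets have the same dimension. -/
def IsPureComplex {α : Type*} (Δ : Finset (Finset α)) : Prop :=
  ∀ F G, IsFacet Δ F → IsFacet Δ G → F.card = G.card

/-- `f` is the fine f-vector of the colored complex `(Δ, V)` of type `a`. -/
def HasFineFVector {α : Type*} [DecidableEq α] {n : ℕ} (a : Fin n → ℕ)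
    (Δ : Finset (Finset α)) (V : Fin n → Finset α) (f : (Fin n → ℕ) → ℤ) : Prop :=
  ∀ b : Fin n → ℕ, (∀ i, b i ≤ a i) →
    f b = ((Δ.filter fun F => ∀ i, (F ∩ V i).card = b i).card : ℤ)

theorem mem_vertexSet {α : Type*} [DecidableEq α] {Δ : Finset (Finset α)} {x : α} :
    x ∈ vertexSet Δ ↔ ∃ F ∈ Δ, x ∈ F := by
  simp [vertexSet, Finset.mem_sup]

namespace UV

theorem compress_singleton {α : Type*} [DecidableEq α] (u v : α) (F : Finset α) :
    compress {u} {v} F = if u ∉ F ∧ v ∈ F then insert u (F.erase v) else F := by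
  by_cases h : u ∉ F ∧ v ∈ F
  · have huv : u ≠ v := fun e => h.1 (e ▸ h.2)
    rw [compress, if_pos (by simpa using h), if_pos h]
    ext x
    simp only [sup_eq_union, mem_sdiff, mem_union, mem_singleton, mem_insert, mem_erase]
    grind
  · rw [compress, if_neg (by simpa using h), if_neg h]

/-- Compression commutes with restriction to a subfamily defined by a compression-invariant
predicate. -/
theorem filter_compression {α : Type*} [DecidableEq α] (u v : Finset α)
    (s : Finset (Finset α)) (P : Finset α → Prop) [DecidablePred P]
    (hP : ∀ F, P (compress u v F) ↔ P F) :
    (compression u v s).filter P = compression u v (s.filter P) := by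
  ext F
  simp only [mem_filter, mem_compression, hP]
  constructor
  · rintro ⟨h | ⟨h, B, hB, rfl⟩, hF⟩
    · exact Or.inl ⟨⟨h.1, hF⟩, h.2, hF⟩
    · exact Or.inr ⟨fun h' => h h'.1, B, ⟨hB, (hP B).1 hF⟩, rfl⟩
  · rintro (h | ⟨h, B, ⟨hB, hPB⟩, rfl⟩)
    · exact ⟨Or.inl ⟨h.1.1, h.2.1⟩, h.1.2⟩
    · have hF := (hP B).2 hPB
      exact ⟨Or.inr ⟨fun h' => h ⟨h', hF⟩, B, hB, rfl⟩, hF⟩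

/-- The shift of a simplicial complex is again a simplicial complex. -/
theorem isSimplicialComplex_compression {α : Type*} [DecidableEq α] {u v : α}
    {Δ : Finset (Finset α)} (hΔ : IsSimplicialComplex Δ) :
    IsSimplicialComplex (compression {u} {v} Δ) := by
  refine ⟨?_, fun F hF G hG => ?_⟩
  · rw [← card_pos, card_compression, card_pos]
    exact hΔ.1
  · have hd := hΔ.2
    simp only [mem_compression, compress_singleton] at hF ⊢
    rcases hF with ⟨hF, hF'⟩ | ⟨hF, B, hB, hBF⟩
    · refine Or.inl ⟨hd F hF G hG, ?_⟩
      split_ifs with h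
      · split_ifs at hF' with h'
        · exact hd _ hF' _ (insert_subset_insert _ (erase_subset_erase _ hG))
        · refine hd F hF _ (insert_subset ?_ ((erase_subset _ _).trans hG))
          by_contra hu
          exact h' ⟨hu, hG h.2⟩
      · exact hd F hF G hG
    · split_ifs at hBF with h
      · have huv : u ≠ v := fun e => h.1 (e ▸ h.2)
        have hv : v ∉ G := fun hv => by
          have := hG hv
          rw [← hBF] at this
          grind
        rw [if_neg (fun h' => hv h'.2)]
        by_cases hGΔ : G ∈ Δ
        · exact Or.inl ⟨hGΔ, hGΔ⟩
        · refine Or.inr ⟨hGΔ, insert v (G.erase u), hd B hB _ ?_, ?_⟩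
          · intro x hx
            have := @hG x
            rw [← hBF] at this
            grind
          · have hu : u ∈ G := by
              by_contra hu
              refine hGΔ (hd B hB G fun x hx => ?_)
              have := hG hx
              rw [← hBF] at this
              grind
            rw [if_pos (by grind)]
            grind
      · exact absurd (hBF ▸ hB) hF

/-- Shifting between two vertices does not change the vertex set. -/
theorem vertexSet_compression {α : Type*} [DecidableEq α] {u v : α}
    {Δ : Finset (Finset α)} (hΔ : IsSimplicialComplex Δ) (hu : u ∈ vertexSet Δ) :
    vertexSet (compression {u} {v} Δ) = vertexSet Δ := by
  have hsingle : ∀ x ∈ vertexSet Δ, {x} ∈ Δ := fun x hx => by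
    obtain ⟨F, hF, hxF⟩ := mem_vertexSet.1 hx
    exact hΔ.2 F hF _ (by simpa using hxF)
  ext x
  constructor
  · intro hx
    obtain ⟨F, hF, hxF⟩ := mem_vertexSet.1 hx
    rcases mem_compression.1 hF with h | ⟨-, B, hB, rfl⟩
    · exact mem_vertexSet.2 ⟨F, h.1, hxF⟩
    · rw [compress_singleton] at hxF
      by_cases hxu : x = u
      · exact hxu ▸ hu
      · exact mem_vertexSet.2 ⟨B, hB, by grind⟩
  · intro hx
    refine mem_vertexSet.2 ⟨{x}, mem_compression.2 (Or.inl ⟨hsingle x hx, ?_⟩), by simp⟩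
    rw [compress_singleton]
    split_ifs with h
    · have : x = v := (mem_singleton.1 h.2).symm
      subst this
      simpa using hsingle u hu
    · exact hsingle x hx

/-- Replacing a vertex by one of the same color preserves the color counts. -/
theorem card_compress_inter {α ι : Type*} [DecidableEq α] {V : ι → Finset α}
    (hV : ∀ i j, i ≠ j → Disjoint (V i) (V j)) {j : ι} {u v : α} (hu : u ∈ V j) (hv : v ∈ V j)
    (F : Finset α) (i : ι) : (compress {u} {v} F ∩ V i).card = (F ∩ V i).card := by
  rw [compress_singleton]
  split_ifs with h
  · by_cases hij : i = j
    · subst hij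
      rw [insert_inter_of_mem hu, erase_inter, card_insert_of_notMem (by grind),
        card_erase_add_one (by grind)]
    · have hui : u ∉ V i := fun h' => disjoint_left.1 (hV i j hij) h' hu
      have hvi : v ∉ V i := fun h' => disjoint_left.1 (hV i j hij) h' hv
      rw [insert_inter_of_notMem hui, erase_inter, erase_eq_of_notMem (by grind)]
  · rfl

/-- A shift towards a smaller vertex that moves some face strictly decreases the total of all
vertex labels. -/
theorem sum_compression_lt {u v : ℕ} (huv : u < v) {Δ : Finset (Finset ℕ)} {F : Finset ℕ}
    (hF : F ∈ Δ) (hF' : compress {u} {v} F ∉ Δ) :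
    ∑ G ∈ compression {u} {v} Δ, ∑ x ∈ G, x < ∑ G ∈ Δ, ∑ x ∈ G, x := by
  have hlt : ∀ G ∈ Δ, compress {u} {v} G ∉ Δ →
      ∑ x ∈ compress {u} {v} G, x < ∑ x ∈ G, x := fun G hG hG' => by
    rw [compress_singleton] at hG' ⊢
    split_ifs at hG' ⊢ with h
    · rw [sum_insert (by grind), ← add_sum_erase G (fun x => x) h.2]
      exact Nat.add_lt_add_right huv _
    · exact absurd hG hG'
  have hunion : compression {u} {v} Δ = {G ∈ Δ | compress {u} {v} G ∈ Δ} ∪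
      {G ∈ Δ | compress {u} {v} G ∉ Δ}.image (compress {u} {v}) := by
    ext G
    simp only [mem_compression, mem_union, mem_filter, mem_image]
    grind
  have hdisj : Disjoint {G ∈ Δ | compress {u} {v} G ∈ Δ}
      ({G ∈ Δ | compress {u} {v} G ∉ Δ}.image (compress {u} {v})) := by
    rw [disjoint_left]
    grind
  rw [hunion, sum_union hdisj,
    ← sum_filter_add_sum_filter_not Δ (fun G => compress {u} {v} G ∈ Δ)]
  refine Nat.add_lt_add_left ?_ _
  rw [sum_image fun G hG H hH h => compress_injOn (by simpa using hG) (by simpa using hH) h]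
  refine sum_lt_sum_of_nonempty ⟨F, by simp [hF, hF']⟩ fun G hG => ?_
  rw [mem_filter] at hG
  exact hlt G hG.1 hG.2

end UV

theorem IsColoredComplex.compression {α : Type*} [DecidableEq α] {n : ℕ} {a : Fin n → ℕ}
    {Δ : Finset (Finset α)} {V : Fin n → Finset α} (h : IsColoredComplex a Δ V) {j : Fin n}
    {u v : α} (hu : u ∈ V j) (hv : v ∈ V j) :
    IsColoredComplex a (UV.compression {u} {v} Δ) V := by
  obtain ⟨hΔ, hV, ha⟩ := h
  have huΔ : u ∈ vertexSet Δ := hV.2.2 ▸ mem_biUnion.2 ⟨j, mem_univ j, hu⟩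
  refine ⟨UV.isSimplicialComplex_compression hΔ, ?_, fun F hF i => ?_⟩
  · rwa [UV.vertexSet_compression hΔ huΔ]
  · rcases UV.mem_compression.1 hF with h | ⟨-, B, hB, rfl⟩
    · exact ha F h.1 i
    · rw [UV.card_compress_inter hV.2.1 hu hv]
      exact ha B hB i

theorem HasFineFVector.compression {α : Type*} [DecidableEq α] {n : ℕ} {a : Fin n → ℕ}
    {Δ : Finset (Finset α)} {V : Fin n → Finset α} {f : (Fin n → ℕ) → ℤ}
    (h : HasFineFVector a Δ V f) (hV : ∀ i j, i ≠ j → Disjoint (V i) (V j)) {j : Fin n}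
    {u v : α} (hu : u ∈ V j) (hv : v ∈ V j) :
    HasFineFVector a (UV.compression {u} {v} Δ) V f := by
  intro b hb
  rw [UV.filter_compression _ _ _ _ fun F => by simp only [UV.card_compress_inter hV hu hv],
    UV.card_compression]
  exact h b hb

/-- Every colored complex can be shifted to a color-shifted one with the same coloring and the
same fine f-vector. -/
theorem exists_isColorShifted {n : ℕ} {a : Fin n → ℕ} {V : Fin n → Finset ℕ}
    {f : (Fin n → ℕ) → ℤ} (Δ : Finset (Finset ℕ)) (hΔ : IsColoredComplex a Δ V)
    (hf : HasFineFVector a Δ V f) :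
    ∃ Γ, IsColoredComplex a Γ V ∧ IsColorShifted Γ V ∧ HasFineFVector a Γ V f := by
  by_cases hs : IsColorShifted Δ V
  · exact ⟨Δ, hΔ, hs, hf⟩
  · unfold IsColorShifted at hs
    push Not at hs
    obtain ⟨F, hF, i, v, hv, u, hu, huv, hvF, huF, hshift⟩ := hs
    have hlt := UV.sum_compression_lt huv hF
      (by rwa [UV.compress_singleton, if_pos ⟨huF, hvF⟩])
    exact exists_isColorShifted (UV.compression {u} {v} Δ) (hΔ.compression hu hv)
      (hf.compression hΔ.2.1.2.1 hu hv)
termination_by ∑ G ∈ Δ, ∑ x ∈ G, x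

/-- An array of integers is the fine f-vector of a colored
complex of type `a` iff it is the fine f-vector of a color-shifted colored
complex of type `a`. -/
theorem fineFVector_iff_colorShifted {n : ℕ} (hn : 0 < n)
    (a : Fin n → ℕ) (ha : ∀ i, 0 < a i) (f : (Fin n → ℕ) → ℤ) :
    (∃ (Δ : Finset (Finset ℕ)) (V : Fin n → Finset ℕ),
        IsColoredComplex a Δ V ∧ HasFineFVector a Δ V f) ↔
      (∃ (Δ : Finset (Finset ℕ)) (V : Fin n → Finset ℕ),
        IsColoredComplex a Δ V ∧ IsColorShifted Δ V ∧
          HasFineFVector a Δ V f) := by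
  constructor
  · rintro ⟨Δ, V, hΔ, hf⟩
    obtain ⟨Γ, hΓ⟩ := exists_isColorShifted Δ hΔ hf
    exact ⟨Γ, V, hΓ⟩
  · rintro ⟨Δ, V, hΔ, -, hf⟩
    exact ⟨Δ, V, hΔ, hf⟩
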